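/- Let X, Y be compact metric spaces, f : X → X, g : Y → Y continuous maps, C a chain component of f, C' a chain component of g, and h : (C, f|_C) → (C', g|_{C'}) a topological conjugacy. Then for any x, y ∈ C, x ∼_C y if and only if h(x) ∼_{C'} h(y); consequently h(D) ∈ 𝒟(C') for every D ∈ 𝒟(C), and the map D ↦ h(D) is a bijection from 𝒟(C) onto 𝒟(C'). -/

import Mathlib

open Filter Metric Set Topology

section Defs

variable {X : Type*} [MetricSpace X]

/-- A δ-chain of `f` of length `k` (with `k ≥ 1`) within the set `C`, from `x` to `y`. -/
def ChainIn (f : X → X) (C : Set X) (δ : ℝ) (k : ℕ) (x y : X) : Prop :=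
  1 ≤ k ∧ ∃ c : ℕ → X, c 0 = x ∧ c k = y ∧ (∀ i ≤ k, c i ∈ C) ∧
    ∀ i < k, dist (f (c i)) (c (i + 1)) ≤ δ

/-- `x → y` : for every `δ > 0` there is a `δ`-chain of `f` from `x` to `y`. -/
def ChainReach (f : X → X) (x y : X) : Prop :=
  ∀ δ > 0, ∃ k, ChainIn f Set.univ δ k x y

/-- `x` is chain recurrent for `f`. -/
def ChainRecurrent (f : X → X) (x : X) : Prop := ChainReach f x x

/-- `C` is a chain component of `f`: an equivalence class of the relation `↔`
on the set of chain recurrent points. -/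
def IsChainComponent (f : X → X) (C : Set X) : Prop :=
  ∃ x, ChainRecurrent f x ∧
    C = {y | ChainRecurrent f y ∧ ChainReach f x y ∧ ChainReach f y x}

/-- The set of lengths of δ-cycles of `f` restricted to `C`. -/
def cycleLengths (f : X → X) (C : Set X) (δ : ℝ) : Set ℕ :=
  {k | ∃ x ∈ C, ChainIn f C δ k x x}

/-- The greatest common divisor of a set of natural numbers
(the greatest natural number dividing every element). -/
noncomputable def setGcd (S : Set ℕ) : ℕ := sSup {d | ∀ k ∈ S, d ∣ k}

/-- `x ∼_{C,δ} y` : there is a δ-chain of `f|_C` from `x` to `y` whose length is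
divisible by `m(C,δ)`, the gcd of the lengths of all δ-cycles of `f|_C`. -/
def SimCd (f : X → X) (C : Set X) (δ : ℝ) (x y : X) : Prop :=
  ∃ k, setGcd (cycleLengths f C δ) ∣ k ∧ ChainIn f C δ k x y

/-- `x ∼_C y` : `x ∼_{C,δ} y` for all `δ > 0`. -/
def SimC (f : X → X) (C : Set X) (x y : X) : Prop :=
  ∀ δ > 0, SimCd f C δ x y

/-- `𝒟(C,δ)` : the set of equivalence classes of `∼_{C,δ}`. -/
def DClassesd (f : X → X) (C : Set X) (δ : ℝ) : Set (Set X) :=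
  {D | ∃ x ∈ C, D = {y ∈ C | SimCd f C δ x y}}

/-- `𝒟(C)` : the set of equivalence classes of `∼_C`. -/
def DClasses (f : X → X) (C : Set X) : Set (Set X) :=
  {D | ∃ x ∈ C, D = {y ∈ C | SimC f C x y}}

/-- `W^s(C) = {x : lim_{i→∞} d(f^i(x), C) = 0}`. -/
def wStable (f : X → X) (C : Set X) : Set X :=
  {x | Tendsto (fun i => infDist (f^[i] x) C) atTop (nhds 0)}

/-- `V^s(D) = ⋂_{δ>0} {x ∈ W^s(C) : lim_{i→∞} d(f^i(x), f^i(D_δ)) = 0}`, where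
`D_δ` is the unique element of `𝒟(C,δ)` containing `D`. -/
def vStable (f : X → X) (C D : Set X) : Set X :=
  {x | x ∈ wStable f C ∧ ∀ δ > 0, ∀ Dd ∈ DClassesd f C δ, D ⊆ Dd →
    Tendsto (fun i => infDist (f^[i] x) (f^[i] '' Dd)) atTop (nhds 0)}

/-- The s-limit shadowing property. -/
def SLimitShadowing (f : X → X) : Prop :=
  ∀ ε > 0, ∃ δ > 0, ∀ x : ℕ → X,
    (∀ i, dist (f (x i)) (x (i + 1)) ≤ δ) →
    Tendsto (fun i => dist (f (x i)) (x (i + 1))) atTop (nhds 0) →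
    ∃ z : X, (∀ i, dist (f^[i] z) (x i) ≤ ε) ∧
      Tendsto (fun i => dist (f^[i] z) (x i)) atTop (nhds 0)

/-- The limit shadowing property. -/
def LimitShadowing (f : X → X) : Prop :=
  ∀ x : ℕ → X, Tendsto (fun i => dist (f (x i)) (x (i + 1))) atTop (nhds 0) →
    ∃ z : X, Tendsto (fun i => dist (f^[i] z) (x i)) atTop (nhds 0)

/-- The (plain) shadowing property. -/
def ShadowingProperty (f : X → X) : Prop :=
  ∀ ε > 0, ∃ δ > 0, ∀ x : ℕ → X, (∀ i, dist (f (x i)) (x (i + 1)) ≤ δ) →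
    ∃ z : X, ∀ i, dist (f^[i] z) (x i) ≤ ε

/-- A Furstenberg family: hereditary upward and proper. -/
def FurstenbergFamily (F : Set (Set ℕ)) : Prop :=
  (∀ A B : Set ℕ, A ∈ F → A ⊆ B → B ∈ F) ∧ F.Nonempty ∧ F ≠ Set.univ

/-- A full Furstenberg family. -/
def FullFamily (F : Set (Set ℕ)) : Prop :=
  ∀ A ∈ F, ∀ n : ℕ, {i ∈ A | n ≤ i} ∈ F

/-- A translation invariant Furstenberg family. -/
def TranslationInvariantFamily (F : Set (Set ℕ)) : Prop :=
  ∀ A ∈ F, ∀ n : ℕ, ((fun i => i + n) '' A ∈ F ∧ {i | i + n ∈ A} ∈ F)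

/-- `S_f(x₁,…,xₙ; r) = {i : min_{j<k} d(fⁱ(x_j), fⁱ(x_k)) > r}`. -/
def Sset (f : X → X) {n : ℕ} (x : Fin n → X) (r : ℝ) : Set ℕ :=
  {i | ∀ j k : Fin n, j < k → r < dist (f^[i] (x j)) (f^[i] (x k))}

/-- `T_f(x₁,…,xₙ; r) = {i : max_{j<k} d(fⁱ(x_j), fⁱ(x_k)) < r}`. -/
def Tset (f : X → X) {n : ℕ} (x : Fin n → X) (r : ℝ) : Set ℕ :=
  {i | ∀ j k : Fin n, j < k → dist (f^[i] (x j)) (f^[i] (x k)) < r}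

/-- `(x₁,…,xₙ)` is an `(ℱ,𝒢)`-δ-scrambled n-tuple for `f`. -/
def Scrambled (f : X → X) (F G : Set (Set ℕ)) (δ : ℝ) {n : ℕ} (x : Fin n → X) : Prop :=
  Sset f x δ ∈ F ∧ ∀ ε > 0, Tset f x ε ∈ G

/-- `Y` is dense `(ℱ,𝒢)`-n-δ-chaotic for `f`: the `(ℱ,𝒢)`-δ-scrambled n-tuples in `Yⁿ`
form a dense subset of `Yⁿ`. -/
def DenseChaotic (f : X → X) (F G : Set (Set ℕ)) (n : ℕ) (δ : ℝ) (Y : Set X) : Prop :=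
  {x : Fin n → X | ∀ j, x j ∈ Y} ⊆
    closure {x : Fin n → X | (∀ j, x j ∈ Y) ∧ Scrambled f F G δ x}

/-- `S` is a residual subset of the subspace `T`: it contains a countable intersection of
dense open subsets of `T`. -/
def ResidualIn {α : Type*} [TopologicalSpace α] (T S : Set α) : Prop :=
  ∃ U : ℕ → Set α, (∀ i, IsOpen (U i)) ∧ (∀ i, T ⊆ closure (U i ∩ T)) ∧
    (⋂ i, U i) ∩ T ⊆ S

/-- `Y` is generic `(ℱ,𝒢)`-n-δ-chaotic for `f`: the `(ℱ,𝒢)`-δ-scrambled n-tuples in `Yⁿ`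
form a residual subset of `Yⁿ`. -/
def GenericChaotic (f : X → X) (F G : Set (Set ℕ)) (n : ℕ) (δ : ℝ) (Y : Set X) : Prop :=
  ResidualIn {x : Fin n → X | ∀ j, x j ∈ Y}
    {x : Fin n → X | (∀ j, x j ∈ Y) ∧ Scrambled f F G δ x}

/-- A Furstenberg family `F` is compatible with `(Z, g)`. -/
def CompatibleFamily {Z : Type*} [TopologicalSpace Z] (F : Set (Set ℕ)) (g : Z → Z) : Prop :=
  ∀ U : Set Z, IsOpen U → IsGδ {z | {i | g^[i] z ∈ U} ∈ F}

end Defs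

section ChainStep

variable {X : Type*} [MetricSpace X] {f : X → X} {x y z : X} {δ : ℝ}

/-- One step of a `δ`-chain of `f`. -/
def ChainStep (f : X → X) (δ : ℝ) (x y : X) : Prop := dist (f x) y ≤ δ

lemma exists_chainIn_univ_iff_transGen :
    (∃ k, ChainIn f univ δ k x y) ↔ Relation.TransGen (ChainStep f δ) x y := by
  constructor
  · rintro ⟨k, hk, c, rfl, rfl, -, hstep⟩
    induction k, hk using Nat.le_induction with
    | base => exact .single (hstep 0 one_pos)
    | succ n _ ih =>
      exact (ih fun i hi => hstep i (hi.trans n.lt_succ_self)).tail (hstep n n.lt_succ_self)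
  · intro h
    induction h with
    | @single b h =>
      refine ⟨1, le_rfl, fun i => if i = 0 then x else b, by simp, by simp, by simp, ?_⟩
      intro i hi
      obtain rfl : i = 0 := by omega
      simpa [ChainStep] using h
    | @tail b c _ hbc ih =>
      obtain ⟨k, hk, w, hw0, hwk, -, hw⟩ := ih
      refine ⟨k + 1, by omega, fun i => if i ≤ k then w i else c, by simpa using hw0,
        by simp, by simp, fun i hi => ?_⟩
      rcases (Nat.lt_succ_iff.1 hi).lt_or_eq with hik | rfl
      · simpa [hik.le, Nat.succ_le_iff.2 hik] using hw i hik
      · simpa [hwk, ChainStep] using hbc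

lemma chainReach_iff_transGen :
    ChainReach f x y ↔ ∀ δ > 0, Relation.TransGen (ChainStep f δ) x y :=
  forall₂_congr fun _ _ => exists_chainIn_univ_iff_transGen

lemma ChainReach.trans (hxy : ChainReach f x y) (hyz : ChainReach f y z) : ChainReach f x z := by
  rw [chainReach_iff_transGen] at *
  exact fun δ hδ => (hxy δ hδ).trans (hyz δ hδ)

lemma chainReach_apply (f : X → X) (x : X) : ChainReach f x (f x) :=
  chainReach_iff_transGen.2 fun δ hδ => .single (by simpa [ChainStep] using hδ.le)

lemma transGen_chainStep_of_dist_apply_left (h : Relation.TransGen (ChainStep f (δ / 2)) y z)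
    (hδ : 0 ≤ δ) (hxy : dist (f x) (f y) ≤ δ / 2) : Relation.TransGen (ChainStep f δ) x z := by
  obtain ⟨b, hyb, hbz⟩ := Relation.TransGen.head'_iff.1 h
  refine .head' (b := b) ?_ (Relation.ReflTransGen.mono (fun _ _ h => h.trans (by linarith)) _ _ hbz)
  have := dist_triangle (f x) (f y) b
  unfold ChainStep at *
  linarith

lemma transGen_chainStep_of_dist_right (h : Relation.TransGen (ChainStep f (δ / 2)) x y)
    (hδ : 0 ≤ δ) (hyz : dist y z ≤ δ / 2) : Relation.TransGen (ChainStep f δ) x z := by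
  obtain ⟨b, hxb, hby⟩ := Relation.TransGen.tail'_iff.1 h
  refine .tail' (Relation.ReflTransGen.mono (fun _ _ h => h.trans (by linarith)) _ _ hxb) (c := z) ?_
  have := dist_triangle (f b) y z
  unfold ChainStep at *
  linarith

lemma ChainReach.apply_left (hf : Continuous f) (hxy : ChainReach f x y) (hy : ChainRecurrent f y) :
    ChainReach f (f x) y := by
  unfold ChainRecurrent at hy
  rw [chainReach_iff_transGen] at *
  intro δ hδ
  obtain ⟨η, hη, hfη⟩ := Metric.continuous_iff.1 hf (f x) (δ / 2) (half_pos hδ)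
  have hle := min_le_left (η / 2) (δ / 2)
  have hpos : 0 < min (η / 2) (δ / 2) := by positivity
  obtain ⟨b, hxb, hby⟩ := Relation.TransGen.head'_iff.1 (hxy _ hpos)
  have hb : Relation.TransGen (ChainStep f (δ / 2)) b y :=
    Relation.TransGen.mono (fun _ _ h => h.trans (min_le_right _ _)) _ _
      (Relation.TransGen.trans_right hby (hy _ hpos))
  refine transGen_chainStep_of_dist_apply_left hb hδ.le ?_
  rw [dist_comm]
  refine (hfη b ?_).le
  rw [dist_comm]
  unfold ChainStep at hxb
  linarith

lemma IsChainComponent.mapsTo {C : Set X} (hC : IsChainComponent f C) (hf : Continuous f) :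
    MapsTo f C C := by
  obtain ⟨x, hx, rfl⟩ := hC
  rintro y ⟨-, hxy, hyx⟩
  have h₁ := hxy.trans (chainReach_apply f y)
  have h₂ := hyx.apply_left hf hx
  exact ⟨h₂.trans h₁, h₁, h₂⟩

lemma isClosed_setOf_chainReach_right (f : X → X) (x : X) : IsClosed {y | ChainReach f x y} := by
  refine isClosed_of_closure_subset fun y hy => chainReach_iff_transGen.2 fun δ hδ => ?_
  obtain ⟨z, hz, hyz⟩ := Metric.mem_closure_iff.1 hy (δ / 2) (half_pos hδ)
  refine transGen_chainStep_of_dist_right (chainReach_iff_transGen.1 hz _ (half_pos hδ)) hδ.le ?_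
  rw [dist_comm]
  exact hyz.le

lemma isClosed_setOf_chainReach_left (hf : Continuous f) (x : X) :
    IsClosed {y | ChainReach f y x} := by
  refine isClosed_of_closure_subset fun y hy => chainReach_iff_transGen.2 fun δ hδ => ?_
  obtain ⟨η, hη, hfη⟩ := Metric.continuous_iff.1 hf y (δ / 2) (half_pos hδ)
  obtain ⟨z, hz, hyz⟩ := Metric.mem_closure_iff.1 hy η hη
  refine transGen_chainStep_of_dist_apply_left
    (chainReach_iff_transGen.1 hz _ (half_pos hδ)) hδ.le ?_
  rw [dist_comm]
  exact (hfη z (by rwa [dist_comm])).le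

lemma IsChainComponent.isClosed {C : Set X} (hC : IsChainComponent f C) (hf : Continuous f) :
    IsClosed C := by
  obtain ⟨x, -, rfl⟩ := hC
  convert (isClosed_setOf_chainReach_right f x).inter (isClosed_setOf_chainReach_left hf x)
    using 1
  ext y
  exact ⟨fun h => h.2, fun h => ⟨h.2.trans h.1, h⟩⟩

end ChainStep

lemma setGcd_dvd_setGcd_of_subset {S T : Set ℕ} (hST : S ⊆ T) (hS : ∃ k ∈ S, 0 < k) :
    setGcd T ∣ setGcd S := by
  obtain ⟨k, hk, hk0⟩ := hS
  have hbdd : ∀ U : Set ℕ, k ∈ U → BddAbove {d | ∀ j ∈ U, d ∣ j} := fun U hU =>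
    ⟨k, fun _ hd => Nat.le_of_dvd hk0 (hd k hU)⟩
  have hmem : ∀ U : Set ℕ, k ∈ U → ∀ j ∈ U, setGcd U ∣ j := fun U hU =>
    Nat.sSup_mem (s := {d | ∀ j ∈ U, d ∣ j}) ⟨1, fun _ _ => one_dvd _⟩ (hbdd U hU)
  have hlcm : Nat.lcm (setGcd S) (setGcd T) ≤ setGcd S :=
    le_csSup (hbdd S hk) fun j hj =>
      Nat.lcm_dvd (hmem S hk j hj) (hmem T (hST hk) j (hST hj))
  have hpos : 0 < setGcd S := Nat.pos_of_dvd_of_pos (hmem S hk k hk) hk0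
  have hle : setGcd S ≤ Nat.lcm (setGcd S) (setGcd T) :=
    Nat.le_of_dvd (Nat.pos_of_dvd_of_pos
      (Nat.lcm_dvd (hmem S hk k hk) (hmem T (hST hk) k (hST hk))) hk0) (Nat.dvd_lcm_left _ _)
  exact hlcm.antisymm hle ▸ Nat.dvd_lcm_right _ _

section Map

variable {X Y : Type*} [MetricSpace X] [MetricSpace Y] {f : X → X} {g : Y → Y}
  {C : Set X} {C' : Set Y} {h : X → Y} {x y : X}

lemma ChainIn.map {δ ε : ℝ} {k : ℕ} (hc : ChainIn f C δ k x y) (hfC : MapsTo f C C)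
    (hh : MapsTo h C C') (hconj : ∀ x ∈ C, h (f x) = g (h x))
    (hδε : ∀ a ∈ C, ∀ b ∈ C, dist a b ≤ δ → dist (h a) (h b) ≤ ε) :
    ChainIn g C' ε k (h x) (h y) := by
  obtain ⟨hk, c, rfl, rfl, hcC, hstep⟩ := hc
  refine ⟨hk, h ∘ c, rfl, rfl, fun i hi => hh (hcC i hi), fun i hi => ?_⟩
  simp only [Function.comp_apply, ← hconj _ (hcC i hi.le)]
  exact hδε _ (hfC (hcC i hi.le)) _ (hcC (i + 1) hi) (hstep i hi)

lemma SimC.map (hxy : SimC f C x y) (hfC : MapsTo f C C) (hh : MapsTo h C C')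
    (hconj : ∀ x ∈ C, h (f x) = g (h x)) (hunif : UniformContinuousOn h C) :
    SimC g C' (h x) (h y) := by
  intro ε hε
  obtain ⟨δ, hδ, hδε⟩ := Metric.uniformContinuousOn_iff_le.1 hunif ε hε
  obtain ⟨k, hdvd, hk⟩ := hxy δ hδ
  have hsub : cycleLengths f C δ ⊆ cycleLengths g C' ε := by
    rintro j ⟨z, hz, hj⟩
    exact ⟨h z, hh hz, hj.map hfC hh hconj hδε⟩
  have hpos : ∃ j ∈ cycleLengths f C δ, 0 < j := by
    by_contra! hne
    have huniv : {d | ∀ j ∈ cycleLengths f C δ, d ∣ j} = univ :=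
      eq_univ_of_forall fun n j hj => by simp [Nat.le_zero.1 (hne j hj)]
    have hgcd : setGcd (cycleLengths f C δ) = 0 := by
      rw [setGcd, huniv, Nat.sSup_of_not_bddAbove not_bddAbove_univ]
    rw [hgcd, zero_dvd_iff] at hdvd
    exact absurd hk.1 (by simp [hdvd])
  exact ⟨k, (setGcd_dvd_setGcd_of_subset hsub hpos).trans hdvd, hk.map hfC hh hconj hδε⟩

end Map

lemma IsCompact.continuousOn_image_of_leftInvOn {X Y : Type*} [TopologicalSpace X]
    [TopologicalSpace Y] [T2Space Y] {C : Set X} {h : X → Y} {k : Y → X} (hC : IsCompact C)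
    (hh : ContinuousOn h C) (hk : LeftInvOn k h C) : ContinuousOn k (h '' C) := by
  refine continuousOn_iff_isClosed.2 fun t ht => ⟨h '' (C ∩ t),
    ((hC.inter_right ht).image_of_continuousOn (hh.mono inter_subset_left)).isClosed, ?_⟩
  ext z
  constructor
  · rintro ⟨hz, x, hx, rfl⟩
    exact ⟨⟨x, ⟨hx, by rwa [mem_preimage, hk hx] at hz⟩, rfl⟩, x, hx, rfl⟩
  · rintro ⟨⟨x, ⟨hx, hxt⟩, rfl⟩, hz⟩
    exact ⟨by rwa [mem_preimage, hk hx], hz⟩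

/-- Remark 2.4: a topological conjugacy `h : (C, f|_C) → (C', g|_{C'})`
preserves the chain proximal relation; consequently `h(D) ∈ 𝒟(C')` for every `D ∈ 𝒟(C)`
and `D ↦ h(D)` is a bijection of `𝒟(C)` onto `𝒟(C')`. -/
theorem conjugacy_preserves_simC_and_DClasses
    {X Y : Type*} [MetricSpace X] [CompactSpace X] [MetricSpace Y] [CompactSpace Y]
    (f : X → X) (g : Y → Y) (hf : Continuous f) (hg : Continuous g)
    (C : Set X) (hC : IsChainComponent f C) (C' : Set Y) (hC' : IsChainComponent g C')
    (h : X → Y) (hcont : ContinuousOn h C) (hinj : Set.InjOn h C) (himg : h '' C = C')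
    (hconj : ∀ x ∈ C, h (f x) = g (h x)) :
    (∀ x ∈ C, ∀ y ∈ C, (SimC f C x y ↔ SimC g C' (h x) (h y))) ∧
    (∀ D ∈ DClasses f C, h '' D ∈ DClasses g C') ∧
    Set.BijOn (fun D => h '' D) (DClasses f C) (DClasses g C') := by
  have hcomp : IsCompact C := (hC.isClosed hf).isCompact
  have hfC : MapsTo f C C := hC.mapsTo hf
  have hgC : MapsTo g C' C' := hC'.mapsTo hg
  have hh : MapsTo h C C' := himg ▸ mapsTo_image h C
  have hsim : ∀ x ∈ C, ∀ y ∈ C, (SimC f C x y ↔ SimC g C' (h x) (h y)) := by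
    intro x hx y hy
    have : Nonempty X := ⟨x⟩
    have hk : LeftInvOn (Function.invFunOn h C) h C := hinj.leftInvOn_invFunOn
    refine ⟨fun hxy => hxy.map hfC hh hconj (hcomp.uniformContinuousOn_of_continuous hcont),
      fun hxy => ?_⟩
    have hkC : MapsTo (Function.invFunOn h C) C' C := by
      rw [← himg]
      rintro _ ⟨z, hz, rfl⟩
      rwa [hk hz]
    have hkconj : ∀ z ∈ C', Function.invFunOn h C (g z) = f (Function.invFunOn h C z) := by
      rw [← himg]
      rintro _ ⟨z, hz, rfl⟩
      rw [← hconj z hz, hk hz, hk (hfC hz)]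
    have hkcont : ContinuousOn (Function.invFunOn h C) C' :=
      himg ▸ hcomp.continuousOn_image_of_leftInvOn hcont hk
    have hcomp' : IsCompact C' := himg ▸ hcomp.image_of_continuousOn hcont
    simpa only [hk hx, hk hy] using
      hxy.map hgC hkC hkconj (hcomp'.uniformContinuousOn_of_continuous hkcont)
  have himage : ∀ x ∈ C, h '' {y ∈ C | SimC f C x y} = {z ∈ C' | SimC g C' (h x) z} := by
    intro x hx
    ext z
    constructor
    · rintro ⟨y, ⟨hy, hxy⟩, rfl⟩
      exact ⟨hh hy, (hsim x hx y hy).1 hxy⟩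
    · rintro ⟨hz, hxz⟩
      obtain ⟨y, hy, rfl⟩ := himg.symm ▸ hz
      exact ⟨y, ⟨hy, (hsim x hx y hy).2 hxz⟩, rfl⟩
  have hmaps : ∀ D ∈ DClasses f C, h '' D ∈ DClasses g C' := by
    rintro _ ⟨x, hx, rfl⟩
    exact ⟨h x, hh hx, himage x hx⟩
  refine ⟨hsim, hmaps, hmaps, hinj.image.mono ?_, ?_⟩
  · rintro _ ⟨x, -, rfl⟩
    exact sep_subset _ _
  · rintro _ ⟨z, hz, rfl⟩
    obtain ⟨x, hx, rfl⟩ := himg.symm ▸ hz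
    exact ⟨_, ⟨x, hx, rfl⟩, himage x hx⟩
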